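/- Let d ≥ 1 and q be an odd prime power with d ≡ 1 (mod 4), or d ≡ 3 (mod 4) and q ≡ 1 (mod 4). If A ⊆ F_q^d is a square distance set, then |A| ≤ q^{(d+1)/2}. -/

import Mathlib

open Finset

/-- `‖x‖ = x₁² + ⋯ + x_d²` for `x ∈ F_q^d`. -/
def normSq {d : ℕ} {F : Type} [Field F] [Fintype F] (x : Fin d → F) : F := ∑ i, x i ^ 2

/-- `A` is a square distance set: every distance `‖x−y‖` (x, y ∈ A) is zero or a
nonzero square of `F_q`. -/
def IsSquareDistanceSet {d : ℕ} {F : Type} [Field F] [Fintype F]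
    (A : Finset (Fin d → F)) : Prop :=
  ∀ x ∈ A, ∀ y ∈ A, normSq (x - y) = 0 ∨ (IsSquare (normSq (x - y)) ∧ normSq (x - y) ≠ 0)

lemma addChar_sum_eq_prod {ι G M : Type*} [AddCommMonoid G] [CommMonoid M] (ψ : AddChar G M)
    (s : Finset ι) (f : ι → G) : ψ (∑ i ∈ s, f i) = ∏ i ∈ s, ψ (f i) := by
  classical
  induction s using Finset.induction_on with
  | empty => simp
  | insert i s hi ih => rw [sum_insert hi, prod_insert hi, AddChar.map_add_eq_mul, ih]

/-- Delsarte's linear programming bound: a set whose nonzero differences are zeros of the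
Fourier transform of a nonnegative weight `g` is small. -/
lemma mul_card_le_sum_of_fourier_eq_zero {F : Type} [Field F] [Fintype F] {d : ℕ} (ψ : AddChar F ℂ)
    (A : Finset (Fin d → F)) (g : (Fin d → F) → ℝ) (hg : ∀ m, 0 ≤ g m)
    (hA : ∀ x ∈ A, ∀ y ∈ A, x ≠ y → ∑ m, (g m : ℂ) * ψ ((x - y) ⬝ᵥ m) = 0) :
    g 0 * #A ≤ ∑ m, g m := by
  rcases A.eq_empty_or_nonempty with rfl | hne
  · simpa using sum_nonneg fun m _ ↦ hg m
  have key : ∑ m, g m * ‖∑ x ∈ A, ψ (x ⬝ᵥ m)‖ ^ 2 = #A * ∑ m, g m := by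
    apply Complex.ofReal_injective
    push_cast
    calc ∑ m, (g m : ℂ) * (‖∑ x ∈ A, ψ (x ⬝ᵥ m)‖ : ℂ) ^ 2
        = ∑ m, ∑ x ∈ A, ∑ y ∈ A, (g m : ℂ) * ψ ((x - y) ⬝ᵥ m) := by
          refine sum_congr rfl fun m _ ↦ ?_
          rw [← Complex.mul_conj', map_sum, sum_mul_sum, mul_sum]
          refine sum_congr rfl fun x _ ↦ ?_
          rw [mul_sum]
          refine sum_congr rfl fun y _ ↦ ?_
          rw [← AddChar.map_neg_eq_conj, ← AddChar.map_add_eq_mul, sub_dotProduct,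
            sub_eq_add_neg]
      _ = ∑ x ∈ A, ∑ y ∈ A, ∑ m, (g m : ℂ) * ψ ((x - y) ⬝ᵥ m) := by
          rw [sum_comm]
          exact sum_congr rfl fun x _ ↦ sum_comm
      _ = ∑ x ∈ A, ∑ m, (g m : ℂ) := by
          refine sum_congr rfl fun x hx ↦ ?_
          rw [sum_eq_single_of_mem x hx fun y hy hxy ↦ hA x hx y hy hxy.symm]
          simp
      _ = #A * ∑ m, (g m : ℂ) := by rw [sum_const, nsmul_eq_mul]
  have hle : g 0 * (#A : ℝ) ^ 2 ≤ #A * ∑ m, g m := by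
    rw [← key]
    refine le_trans (le_of_eq ?_) (single_le_sum
      (fun m _ ↦ mul_nonneg (hg m) (sq_nonneg _)) (mem_univ 0))
    simp
  have hpos : (0 : ℝ) < #A := by exact_mod_cast hne.card_pos
  nlinarith

/-- The quadratic character of a finite field, with values in `ℂ`. -/
noncomputable def complexQuadraticChar (F : Type) [Field F] [Fintype F] [DecidableEq F] :
    MulChar F ℂ :=
  (quadraticChar F).ringHomComp (Int.castRingHom ℂ)

section Characters

variable {F : Type} [Field F] [Fintype F] [DecidableEq F]

local notation "χ" => complexQuadraticChar F

lemma complexQuadraticChar_apply (a : F) : χ a = ((quadraticChar F a : ℤ) : ℂ) := rfl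

lemma complexQuadraticChar_sq {a : F} (ha : a ≠ 0) : χ a ^ 2 = 1 := by
  rw [complexQuadraticChar_apply]
  exact_mod_cast quadraticChar_sq_one ha

lemma complexQuadraticChar_inv (a : F) : χ a⁻¹ = χ a := by
  rcases eq_or_ne a 0 with rfl | ha
  · simp [MulChar.map_zero]
  · have h : χ a⁻¹ * χ a = 1 := by rw [← map_mul, inv_mul_cancel₀ ha, map_one]
    linear_combination χ a * h - χ a⁻¹ * complexQuadraticChar_sq ha

lemma complexQuadraticChar_pow_odd (a : F) (k : ℕ) : χ a ^ (2 * k + 1) = χ a := by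
  rcases eq_or_ne a 0 with rfl | ha
  · simp [MulChar.map_zero]
  · rw [pow_succ, pow_mul, complexQuadraticChar_sq ha, one_pow, one_mul]

lemma complexQuadraticChar_ne_one (hF : ringChar F ≠ 2) : χ ≠ 1 :=
  (MulChar.ringHomComp_ne_one_iff Int.cast_injective).mpr (quadraticChar_ne_one hF)

lemma complexQuadraticChar_isQuadratic : (χ).IsQuadratic :=
  (quadraticChar_isQuadratic F).comp _

/-- A twisted quadratic Gauss sum, with no restriction on the twist. -/
lemma sum_complexQuadraticChar_mul_addChar (hF : ringChar F ≠ 2) (ψ : AddChar F ℂ) (a : F) :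
    ∑ s, χ s * ψ (a * s) = χ a * gaussSum χ ψ := by
  rcases eq_or_ne a 0 with rfl | ha
  · simpa [MulChar.map_zero] using MulChar.sum_eq_zero_of_ne_one (complexQuadraticChar_ne_one hF)
  · have h := gaussSum_mulShift χ ψ (Units.mk0 a ha)
    rw [← h, Units.val_mk0, ← mul_assoc, ← sq, complexQuadraticChar_sq ha, one_mul]
    simp [gaussSum]

lemma sum_addChar_mul_sq (hF : ringChar F ≠ 2) {ψ : AddChar F ℂ} (hψ : ψ ≠ 1) {s : F}
    (hs : s ≠ 0) : ∑ t, ψ (s * t ^ 2) = χ s * gaussSum χ ψ := by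
  have hcount (v : F) : (#{t : F | t ^ 2 = v} : ℂ) = χ v + 1 := by
    rw [complexQuadraticChar_apply]
    have h := quadraticChar_card_sqrts hF v
    rw [Set.toFinset_ofPred] at h
    exact_mod_cast h
  have hzero : ∑ v, ψ (s * v) = 0 := by
    rw [← AddChar.sum_eq_zero_of_ne_one hψ]
    exact Fintype.sum_bijective _ (mulLeft_bijective₀ s hs) _ _ fun _ ↦ rfl
  calc ∑ t, ψ (s * t ^ 2)
      = ∑ v, ∑ t with t ^ 2 = v, ψ (s * t ^ 2) := (sum_fiberwise _ _ _).symm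
    _ = ∑ v, (χ v * ψ (s * v) + ψ (s * v)) := by
        refine sum_congr rfl fun v _ ↦ ?_
        rw [sum_congr rfl (g := fun _ ↦ ψ (s * v)) fun t ht ↦ by rw [(mem_filter.mp ht).2],
          sum_const, nsmul_eq_mul, hcount, add_mul, one_mul]
    _ = χ s * gaussSum χ ψ := by
        rw [sum_add_distrib, hzero, add_zero, sum_complexQuadraticChar_mul_addChar hF]

lemma sum_addChar_quadratic (hF : ringChar F ≠ 2) {ψ : AddChar F ℂ} (hψ : ψ ≠ 1) {s : F}
    (hs : s ≠ 0) (b : F) :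
    ∑ t, ψ (s * t ^ 2 + b * t) = χ s * gaussSum χ ψ * ψ (-b ^ 2 / 4 * s⁻¹) := by
  have h2 : (2 : F) ≠ 0 := Ring.two_ne_zero hF
  have h4 : (4 : F) ≠ 0 := by
    have := mul_ne_zero h2 h2
    norm_num at this
    exact this
  rw [← sum_addChar_mul_sq hF hψ hs, sum_mul]
  refine Fintype.sum_equiv (Equiv.addRight (b / (2 * s))) _ _ fun t ↦ ?_
  rw [← AddChar.map_add_eq_mul, Equiv.coe_addRight]
  congr 1
  field_simp
  ring

variable {d : ℕ}

lemma sum_addChar_normSq_add_dotProduct (hF : ringChar F ≠ 2) {ψ : AddChar F ℂ} (hψ : ψ ≠ 1)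
    {s : F} (hs : s ≠ 0) (m : Fin d → F) :
    ∑ z, ψ (s * normSq z + m ⬝ᵥ z) =
      (χ s * gaussSum χ ψ) ^ d * ψ (-normSq m / 4 * s⁻¹) := by
  have hprod (z : Fin d → F) :
      ψ (s * normSq z + m ⬝ᵥ z) = ∏ i, ψ (s * z i ^ 2 + m i * z i) := by
    rw [← addChar_sum_eq_prod, normSq, dotProduct, mul_sum, sum_add_distrib]
  have hsum := prod_univ_sum (fun _ : Fin d ↦ (univ : Finset F))
    (fun i t ↦ ψ (s * t ^ 2 + m i * t))
  rw [Fintype.piFinset_univ] at hsum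
  rw [sum_congr rfl fun z _ ↦ hprod z, ← hsum,
    prod_congr rfl fun i _ ↦ sum_addChar_quadratic hF hψ hs (m i), prod_mul_distrib,
    prod_const, card_univ, Fintype.card_fin, ← addChar_sum_eq_prod, normSq, ← sum_mul,
    ← sum_div, sum_neg_distrib]

lemma sum_addChar_dotProduct {ψ : AddChar F ℂ} (hψ : ψ.IsPrimitive) (m : Fin d → F) :
    ∑ z, ψ (m ⬝ᵥ z) = if m = 0 then (Fintype.card F : ℂ) ^ d else 0 := by
  have hsum := prod_univ_sum (fun _ : Fin d ↦ (univ : Finset F))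
    (fun i t ↦ ψ (t * m i))
  rw [Fintype.piFinset_univ] at hsum
  have hprod (z : Fin d → F) : ψ (m ⬝ᵥ z) = ∏ i, ψ (z i * m i) := by
    rw [← addChar_sum_eq_prod, dotProduct_comm, dotProduct]
  rw [sum_congr rfl fun z _ ↦ hprod z, ← hsum,
    prod_congr rfl fun i _ ↦ AddChar.sum_mulShift (m i) hψ]
  split_ifs with h
  · simp [h]
  · obtain ⟨i, hi⟩ := Function.ne_iff.mp h
    exact prod_eq_zero (mem_univ i) (by simpa using hi)

lemma sum_addChar_mul_eq_ite {ψ : AddChar F ℂ} (hψ : ψ.IsPrimitive) (a : F) :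
    ∑ s, ψ (a * s) = if a = 0 then (Fintype.card F : ℂ) else 0 := by
  simp_rw [mul_comm a]
  simpa using AddChar.sum_mulShift a hψ

variable {k : ℕ}

lemma gaussSum_pow_odd (hF : ringChar F ≠ 2) {ψ : AddChar F ℂ} (hψ : ψ.IsPrimitive)
    (hk : (χ (-1)) ^ k = 1) :
    gaussSum χ ψ ^ (2 * k + 1) = (Fintype.card F : ℂ) ^ k * gaussSum χ ψ := by
  rw [pow_succ, pow_mul,
    gaussSum_sq (complexQuadraticChar_ne_one hF) complexQuadraticChar_isQuadratic hψ,
    mul_pow, hk, one_mul]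

/-- The Gaussian sums attached to `normSq` in odd dimension, when `normSq` plus the form `-t²`
is hyperbolic. -/
lemma sum_addChar_normSq_odd (hF : ringChar F ≠ 2) {ψ : AddChar F ℂ} (hψ : ψ.IsPrimitive)
    (hψ1 : ψ ≠ 1) (hk : (χ (-1)) ^ k = 1) {s : F} (hs : s ≠ 0) (m : Fin (2 * k + 1) → F) :
    ∑ z, ψ (s * normSq z + m ⬝ᵥ z) =
      (Fintype.card F : ℂ) ^ k * gaussSum χ ψ * (χ s * ψ (-normSq m / 4 * s⁻¹)) := by
  rw [sum_addChar_normSq_add_dotProduct hF hψ1 hs, mul_pow, complexQuadraticChar_pow_odd,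
    gaussSum_pow_odd hF hψ hk]
  ring

lemma complexQuadraticChar_neg_div_four (hF : ringChar F ≠ 2) (a : F) :
    χ (-a / 4) = χ (-1) * χ a := by
  have h2 : (2 : F) ≠ 0 := Ring.two_ne_zero hF
  have h : χ ((2 : F)⁻¹) ^ 2 = 1 := complexQuadraticChar_sq (inv_ne_zero h2)
  have ha : -a / 4 = -1 * a * (2⁻¹ * 2⁻¹) := by
    rw [← mul_inv, div_eq_mul_inv]
    norm_num
  rw [ha, map_mul, map_mul, map_mul _ (2⁻¹ : F), ← sq, h, mul_one]

/-- The Fourier transform of the indicator function of the isotropic cone. -/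
lemma sum_isotropic_mul_addChar (hF : ringChar F ≠ 2) {ψ : AddChar F ℂ} (hψ : ψ.IsPrimitive)
    (hψ1 : ψ ≠ 1) (hk : (χ (-1)) ^ k = 1) (m : Fin (2 * k + 1) → F) :
    ∑ z, (if normSq z = 0 then (Fintype.card F : ℂ) else 0) * ψ (m ⬝ᵥ z) =
      (if m = 0 then (Fintype.card F : ℂ) ^ (2 * k + 1) else 0) +
        (Fintype.card F : ℂ) ^ (k + 1) * χ (normSq m) := by
  have hG := gaussSum_sq (complexQuadraticChar_ne_one hF) complexQuadraticChar_isQuadratic hψ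
  have hneg : χ (-1) ^ 2 = 1 := complexQuadraticChar_sq (neg_ne_zero.mpr one_ne_zero)
  have hsum : ∑ s, χ s * ψ (-normSq m / 4 * s⁻¹) = χ (-1) * χ (normSq m) * gaussSum χ ψ := by
    rw [← complexQuadraticChar_neg_div_four hF, ← sum_complexQuadraticChar_mul_addChar hF]
    refine Fintype.sum_equiv (Equiv.inv F) _ _ fun s ↦ ?_
    simp [complexQuadraticChar_inv]
  calc ∑ z, (if normSq z = 0 then (Fintype.card F : ℂ) else 0) * ψ (m ⬝ᵥ z)
      = ∑ s, ∑ z, ψ (s * normSq z + m ⬝ᵥ z) := by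
        rw [sum_comm]
        refine sum_congr rfl fun z _ ↦ ?_
        rw [← sum_addChar_mul_eq_ite hψ, sum_mul]
        refine sum_congr rfl fun s _ ↦ ?_
        rw [AddChar.map_add_eq_mul, mul_comm s]
    _ = ∑ s, ((if s = 0 then ∑ z, ψ (m ⬝ᵥ z) else 0) +
          (Fintype.card F : ℂ) ^ k * gaussSum χ ψ * (χ s * ψ (-normSq m / 4 * s⁻¹))) := by
        refine sum_congr rfl fun s _ ↦ ?_
        rcases eq_or_ne s 0 with rfl | hs
        · simp [MulChar.map_zero]
        · rw [sum_addChar_normSq_odd hF hψ hψ1 hk hs, if_neg hs, zero_add]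
    _ = _ := by
        rw [sum_add_distrib, sum_ite_eq' univ (0 : F), if_pos (mem_univ _),
          sum_addChar_dotProduct hψ, ← mul_sum, hsum]
        linear_combination (Fintype.card F : ℂ) ^ k * χ (-1) * χ (normSq m) * hG +
          (Fintype.card F : ℂ) ^ (k + 1) * χ (normSq m) * hneg

/-- The Fourier transform of the quadratic character of `normSq`. -/
lemma sum_quadratic_mul_addChar (hF : ringChar F ≠ 2) {ψ : AddChar F ℂ} (hψ : ψ.IsPrimitive)
    (hψ1 : ψ ≠ 1) (hk : (χ (-1)) ^ k = 1) (m : Fin (2 * k + 1) → F) :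
    ∑ z, χ (normSq z) * ψ (m ⬝ᵥ z) =
      (Fintype.card F : ℂ) ^ k * ((if normSq m = 0 then (Fintype.card F : ℂ) else 0) - 1) := by
  have h2 : (2 : F) ≠ 0 := Ring.two_ne_zero hF
  have h4 : (4 : F) ≠ 0 := by
    have := mul_ne_zero h2 h2
    norm_num at this
    exact this
  have hG : gaussSum χ ψ ≠ 0 :=
    gaussSum_ne_zero_of_nontrivial (by exact_mod_cast Fintype.card_ne_zero)
      (complexQuadraticChar_ne_one hF) hψ
  have hsum : ∑ s, ψ (-normSq m / 4 * s⁻¹) =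
      if normSq m = 0 then (Fintype.card F : ℂ) else 0 := by
    have h := sum_addChar_mul_eq_ite hψ (-normSq m / 4)
    simp only [div_eq_zero_iff, neg_eq_zero, h4, or_false] at h
    rw [← h]
    exact Fintype.sum_equiv (Equiv.inv F) _ _ fun s ↦ by simp
  refine mul_left_cancel₀ hG ?_
  calc gaussSum χ ψ * ∑ z, χ (normSq z) * ψ (m ⬝ᵥ z)
      = ∑ s, χ s * ∑ z, ψ (s * normSq z + m ⬝ᵥ z) := by
        simp_rw [mul_sum]
        rw [sum_comm]
        refine sum_congr rfl fun z _ ↦ ?_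
        rw [← mul_assoc, mul_comm (gaussSum χ ψ), ← sum_complexQuadraticChar_mul_addChar hF,
          sum_mul]
        refine sum_congr rfl fun s _ ↦ ?_
        rw [AddChar.map_add_eq_mul, mul_comm s, mul_assoc]
    _ = ∑ s, (Fintype.card F : ℂ) ^ k * gaussSum χ ψ *
          (ψ (-normSq m / 4 * s⁻¹) - if s = 0 then 1 else 0) := by
        refine sum_congr rfl fun s _ ↦ ?_
        rcases eq_or_ne s 0 with rfl | hs
        · simp [MulChar.map_zero]
        · rw [sum_addChar_normSq_odd hF hψ hψ1 hk hs, if_neg hs]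
          linear_combination (Fintype.card F : ℂ) ^ k * gaussSum χ ψ *
            ψ (-normSq m / 4 * s⁻¹) * complexQuadraticChar_sq hs
    _ = _ := by
        rw [← mul_sum, sum_sub_distrib, hsum, sum_ite_eq' univ (0 : F), if_pos (mem_univ _)]
        ring

lemma card_le_of_isSquareDistanceSet (hF : ringChar F ≠ 2) (hk : (χ (-1)) ^ k = 1)
    (A : Finset (Fin (2 * k + 1) → F)) (hA : IsSquareDistanceSet A) :
    (#A : ℝ) ≤ (Fintype.card F : ℝ) ^ (k + 1) := by
  obtain ⟨ψ, hψa⟩ := AddChar.exists_apply_ne_zero.mpr (one_ne_zero (α := F))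
  have hψ1 : ψ ≠ 1 := fun h ↦ hψa (by simp [h])
  have hψ : ψ.IsPrimitive := AddChar.IsPrimitive.of_ne_one hψ1
  set q : ℝ := (Fintype.card F : ℝ) with hq
  have hqC : (Fintype.card F : ℂ) = (q : ℂ) := by simp [hq]
  have hq1 : 1 < q := by rw [hq]; exact_mod_cast Fintype.one_lt_card
  have hr : 0 < q ^ k := by positivity
  set g : (Fin (2 * k + 1) → F) → ℝ := fun m ↦
    q ^ k * (q - (if normSq m = 0 then q else 0) - (quadraticChar F (normSq m) : ℤ)) +
      (if m = 0 then q ^ (2 * k) * (q - 1) else 0) with hgdef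
  have hg (m) : 0 ≤ g m := by
    refine add_nonneg (mul_nonneg hr.le ?_) ?_
    · by_cases hm : normSq m = 0
      · simp [hm]
      · rw [if_neg hm]
        rcases quadraticChar_dichotomy hm with h | h <;> rw [h] <;> push_cast <;> linarith
    · split_ifs
      · exact mul_nonneg (by positivity) (by linarith)
      · rfl
  have hg0 : g 0 = q ^ (2 * k) * (q - 1) := by
    have : normSq (0 : Fin (2 * k + 1) → F) = 0 := by simp [normSq]
    simp [hgdef, this]
  have hfourier (z : Fin (2 * k + 1) → F) : ∑ m, (g m : ℂ) * ψ (z ⬝ᵥ m) =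
      (if z = 0 then (q : ℂ) ^ (3 * k + 1) * (q - 1) else 0) +
        (q : ℂ) ^ (2 * k) * (q - (if normSq z = 0 then (q : ℂ) else 0) - q * χ (normSq z)) := by
    have h0 := sum_addChar_dotProduct hψ z
    have h1 := sum_isotropic_mul_addChar hF hψ hψ1 hk z
    have h2 := sum_quadratic_mul_addChar hF hψ hψ1 hk z
    rw [hqC] at h0 h1 h2
    have hexp (m) : (g m : ℂ) * ψ (z ⬝ᵥ m) = (q : ℂ) ^ (k + 1) * ψ (z ⬝ᵥ m) -
        (q : ℂ) ^ k * ((if normSq m = 0 then (q : ℂ) else 0) * ψ (z ⬝ᵥ m)) -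
        (q : ℂ) ^ k * (χ (normSq m) * ψ (z ⬝ᵥ m)) +
        (if m = 0 then (q : ℂ) ^ (2 * k) * (q - 1) else 0) := by
      rw [hgdef, complexQuadraticChar_apply]
      have hite : ((if normSq m = 0 then q else 0 : ℝ) : ℂ) =
          if normSq m = 0 then (q : ℂ) else 0 := by split_ifs <;> simp
      by_cases hm : m = 0
      · subst hm
        simp only [if_true, dotProduct_zero, AddChar.map_zero_eq_one]
        push_cast [hite]
        ring
      · simp only [hm, if_false]
        push_cast [hite]
        ring
    rw [sum_congr rfl fun m _ ↦ hexp m, sum_add_distrib, sum_sub_distrib, sum_sub_distrib,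
      ← mul_sum, ← mul_sum, ← mul_sum, h0, h1, h2, sum_ite_eq' univ (0 : Fin (2 * k + 1) → F),
      if_pos (mem_univ _)]
    by_cases hz : z = 0
    · simp only [hz, if_true]
      ring
    · simp only [hz, if_false]
      ring
  have hbound := mul_card_le_sum_of_fourier_eq_zero ψ A g hg fun x hx y hy hxy ↦ by
    rw [hfourier, if_neg (sub_ne_zero.mpr hxy), complexQuadraticChar_apply]
    rcases hA x hx y hy with h | ⟨hsq, h⟩
    · simp [h]
    · rw [(quadraticChar_one_iff_isSquare h).mpr hsq]
      simp [h]
  have htotal : ∑ m, g m = q ^ (3 * k + 1) * (q - 1) := by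
    have h := hfourier 0
    have h0 : normSq (0 : Fin (2 * k + 1) → F) = 0 := by simp [normSq]
    simp only [zero_dotProduct, AddChar.map_zero_eq_one, mul_one, h0, if_true, sub_self,
      MulChar.map_zero, mul_zero, add_zero] at h
    exact_mod_cast h
  rw [hg0, htotal] at hbound
  have hpos : 0 < q ^ (2 * k) * (q - 1) := mul_pos (by positivity) (by linarith)
  refine le_of_mul_le_mul_left (hbound.trans (le_of_eq ?_)) hpos
  ring

end Characters

theorem squareDistanceSet_card_odd_plus (q d : ℕ) (F : Type) [Field F] [Fintype F] [DecidableEq F]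
    (hcard : Fintype.card F = q) (hodd : Odd q)
    (hd : d % 4 = 1 ∨ (d % 4 = 3 ∧ q % 4 = 1)) (hd1 : 1 ≤ d)
    (A : Finset (Fin d → F)) (hA : IsSquareDistanceSet A) :
    (A.card : ℝ) ≤ (q : ℝ) ^ ((d + 1) / 2) := by
  subst hcard
  have hF : ringChar F ≠ 2 := fun h ↦ by
    have := FiniteField.even_card_of_char_two h
    rw [Nat.odd_iff] at hodd
    omega
  obtain ⟨k, rfl⟩ : ∃ k, d = 2 * k + 1 := ⟨d / 2, by omega⟩
  have hexp : (2 * k + 1 + 1) / 2 = k + 1 := by omega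
  rw [hexp]
  refine card_le_of_isSquareDistanceSet hF ?_ A hA
  have hneg : complexQuadraticChar F (-1) ^ 2 = 1 :=
    complexQuadraticChar_sq (neg_ne_zero.mpr one_ne_zero)
  rcases hd with h | ⟨-, h⟩
  · obtain ⟨j, rfl⟩ : ∃ j, k = 2 * j := ⟨k / 2, by omega⟩
    rw [pow_mul, hneg, one_pow]
  · have hsq : IsSquare (-1 : F) := FiniteField.isSquare_neg_one_iff.mpr (by omega)
    rw [complexQuadraticChar_apply,
      (quadraticChar_one_iff_isSquare (neg_ne_zero.mpr one_ne_zero)).mpr hsq]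
    simp
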